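/- Let k ≥ 3 and 1 ≤ j ≤ k−2 be integers, and suppose j ≤ √(2k²/(k−2) + 1) − 1. Then no real number is a Trott number in both base k²+j and base k²+j+2; that is, T_{k²+j} ∩ T_{k²+j+2} = ∅. -/

import Mathlib

open Filter Topology

/-- Number of digits of `a` in base `b`. -/
def digLen (b a : ℕ) : ℕ := (Nat.digits b a).length

/-- Value of the finite continued fraction `[0; a₁, a₂, …, aₙ]`. -/
noncomputable def cfVal : List ℕ → ℝ
  | [] => 0
  | (h :: t) => 1 / ((h : ℝ) + cfVal t)

/-- `a` witnesses that `x` is a Trott number in base `b`: the `a i` (indexed from 0)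
are positive, `x` is the value of the infinite continued fraction `[0; a 0, a 1, …]`,
and the base-`b` expansion of `x` is the concatenation of the base-`b` digit strings
of the partial quotients. -/
def IsTrottWith (b : ℕ) (x : ℝ) (a : ℕ → ℕ) : Prop :=
  (∀ i, 0 < a i) ∧
  Tendsto (fun n => cfVal ((List.range n).map a)) atTop (𝓝 x) ∧
  x = ∑' i : ℕ, (a i : ℝ) / (b : ℝ) ^ (∑ j ∈ Finset.range (i + 1), digLen b (a j))

/-- `x` is a Trott number in base `b`. -/
def IsTrott (b : ℕ) (x : ℝ) : Prop := ∃ a, IsTrottWith b x a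

/-- The set of Trott numbers in base `b`. -/
def TrottSet (b : ℕ) : Set ℝ := {x | IsTrott b x}

/-! ### Digit expansions -/

/-- Value of the concatenation of the base-`b` digit strings of `a 0, a 1, …`. -/
noncomputable def concatVal (b : ℕ) (a : ℕ → ℕ) : ℝ :=
  ∑' i : ℕ, (a i : ℝ) / (b : ℝ) ^ (∑ j ∈ Finset.range (i + 1), digLen b (a j))

lemma lt_pow_digLen {b : ℕ} (hb : 2 ≤ b) (a : ℕ) : a < b ^ digLen b a :=
  Nat.lt_base_pow_length_digits (by omega)

lemma digLen_pos {b a : ℕ} (ha : 0 < a) : 0 < digLen b a :=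
  List.length_pos_iff.mpr (Nat.digits_ne_nil_iff_ne_zero.mpr ha.ne')

lemma pow_digLen_le {b a : ℕ} (hb : 2 ≤ b) (ha : 0 < a) : b ^ digLen b a ≤ b * a := by
  obtain ⟨m, rfl⟩ : ∃ m, b = m + 2 := ⟨b - 2, by omega⟩
  exact Nat.base_pow_length_digits_le' m a ha.ne'

lemma concat_partial_le {b : ℕ} (hb : 2 ≤ b) (a : ℕ → ℕ) (N : ℕ) :
    ∑ i ∈ Finset.range N, (a i : ℝ) / (b : ℝ) ^ (∑ j ∈ Finset.range (i + 1), digLen b (a j))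
      + 1 / (b : ℝ) ^ (∑ j ∈ Finset.range N, digLen b (a j)) ≤ 1 := by
  have hb0 : (0 : ℝ) < b := by exact_mod_cast (by omega : 0 < b)
  induction N with
  | zero => simp
  | succ N ih =>
    rw [Finset.sum_range_succ]
    refine le_trans ?_ ih
    have h : (a N : ℝ) + 1 ≤ (b : ℝ) ^ digLen b (a N) := by
      exact_mod_cast lt_pow_digLen hb (a N)
    rw [add_assoc, ← add_div, Finset.sum_range_succ, pow_add]
    refine add_le_add_right ?_ _
    rw [div_le_div_iff₀ (by positivity) (by positivity)]
    nlinarith [pow_pos hb0 (∑ j ∈ Finset.range N, digLen b (a j))]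

lemma concat_summable {b : ℕ} (hb : 2 ≤ b) (a : ℕ → ℕ) :
    Summable fun i : ℕ =>
      (a i : ℝ) / (b : ℝ) ^ (∑ j ∈ Finset.range (i + 1), digLen b (a j)) := by
  refine summable_of_sum_range_le (c := 1) (fun i => by positivity) fun N => ?_
  have h := concat_partial_le hb a N
  have : (0 : ℝ) ≤ 1 / (b : ℝ) ^ (∑ j ∈ Finset.range N, digLen b (a j)) := by positivity
  linarith

lemma concatVal_nonneg (b : ℕ) (a : ℕ → ℕ) : 0 ≤ concatVal b a :=
  tsum_nonneg fun i => by positivity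

lemma concatVal_le_one {b : ℕ} (hb : 2 ≤ b) (a : ℕ → ℕ) : concatVal b a ≤ 1 := by
  refine Real.tsum_le_of_sum_range_le (fun i => by positivity) fun N => ?_
  have h := concat_partial_le hb a N
  have : (0 : ℝ) ≤ 1 / (b : ℝ) ^ (∑ j ∈ Finset.range N, digLen b (a j)) := by positivity
  linarith

lemma concatVal_eq {b : ℕ} (hb : 2 ≤ b) (a : ℕ → ℕ) :
    concatVal b a * (b : ℝ) ^ digLen b (a 0) = a 0 + concatVal b (fun i => a (i + 1)) := by
  have hb0 : (0 : ℝ) < b := by exact_mod_cast (by omega : 0 < b)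
  have hp : (b : ℝ) ^ digLen b (a 0) ≠ 0 := by positivity
  unfold concatVal
  rw [(concat_summable hb a).tsum_eq_zero_add, add_mul, ← tsum_mul_right]
  congr 1
  · simp [hp]
  · refine tsum_congr fun i => ?_
    rw [Finset.sum_range_succ' _ (i + 1), pow_add]
    field_simp

lemma inv_le_concatVal {b : ℕ} (hb : 2 ≤ b) {a : ℕ → ℕ} (ha : 0 < a 0) :
    1 / (b : ℝ) ≤ concatVal b a := by
  have hb0 : (0 : ℝ) < b := by exact_mod_cast (by omega : 0 < b)
  have h1 := concatVal_eq hb a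
  have h2 := concatVal_nonneg b (fun i => a (i + 1))
  have h3 : (b : ℝ) ^ digLen b (a 0) ≤ b * a 0 := by exact_mod_cast pow_digLen_le hb ha
  have h4 : (0 : ℝ) < (b : ℝ) ^ digLen b (a 0) := by positivity
  rw [div_le_iff₀ hb0]
  by_contra! h
  nlinarith

/-! ### Continued fractions -/

/-- `x` is the value of the infinite continued fraction `[0; a 0, a 1, …]`. -/
def IsCF (a : ℕ → ℕ) (x : ℝ) : Prop :=
  Tendsto (fun n => cfVal ((List.range n).map a)) atTop (𝓝 x)

lemma cfVal_nonneg (l : List ℕ) : 0 ≤ cfVal l := by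
  induction l with
  | nil => simp [cfVal]
  | cons h t ih => simp only [cfVal]; positivity

lemma cfVal_le_one {l : List ℕ} (hl : ∀ h ∈ l, 0 < h) : cfVal l ≤ 1 := by
  cases l with
  | nil => simp [cfVal]
  | cons h t =>
    have h1 : (1 : ℝ) ≤ h := by exact_mod_cast hl h (by simp)
    have h2 := cfVal_nonneg t
    simp only [cfVal]
    rw [div_le_one (by linarith)]
    linarith

lemma cfVal_range_succ (a : ℕ → ℕ) (n : ℕ) :
    cfVal ((List.range (n + 1)).map a) =
      1 / ((a 0 : ℝ) + cfVal ((List.range n).map fun i => a (i + 1))) := by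
  rw [List.range_succ_eq_map, List.map_cons, List.map_map]
  rfl

lemma IsCF.pos {a : ℕ → ℕ} {x : ℝ} (h : IsCF a x) (ha : ∀ i, 0 < a i) : 0 < x := by
  have h0 : (0 : ℝ) < a 0 := by exact_mod_cast ha 0
  refine lt_of_lt_of_le (by positivity : (0 : ℝ) < 1 / (a 0 + 1)) ?_
  refine ge_of_tendsto ((tendsto_add_atTop_iff_nat 1).2 h) (Eventually.of_forall fun n => ?_)
  rw [cfVal_range_succ]
  have h1 := cfVal_nonneg ((List.range n).map fun i => a (i + 1))
  have h2 : cfVal ((List.range n).map fun i => a (i + 1)) ≤ 1 :=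
    cfVal_le_one fun m hm => by
      obtain ⟨i, -, rfl⟩ := List.mem_map.1 hm
      exact ha _
  gcongr

lemma IsCF.tail {a : ℕ → ℕ} {x : ℝ} (h : IsCF a x) (ha : ∀ i, 0 < a i) :
    IsCF (fun i => a (i + 1)) (1 / x - a 0) := by
  have h1 := ((tendsto_add_atTop_iff_nat 1).2 h).inv₀ (h.pos ha).ne'
  refine ((h1.sub_const (a 0 : ℝ)).congr fun n => ?_).trans (by rw [one_div])
  rw [cfVal_range_succ]
  simp

lemma IsCF.lt_one {a : ℕ → ℕ} {x : ℝ} (h : IsCF a x) (ha : ∀ i, 0 < a i) : x < 1 := by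
  have h1 := (h.tail ha).pos fun i => ha (i + 1)
  have h2 : (1 : ℝ) ≤ a 0 := by exact_mod_cast ha 0
  have h3 := h.pos ha
  have h4 : 1 < 1 / x := by linarith
  rwa [lt_div_iff₀ h3, one_mul] at h4

/-! ### The first two partial quotients -/

lemma first_quotient {b k j m n : ℕ} {y z : ℝ} (hb : b = k ^ 2 + j) (hk : 0 < k) (hj1 : 1 ≤ j)
    (hj2 : j ≤ k) (hm : 0 < m) (hn : 0 < n) (hbn : b ^ n ≤ b * m) (hy0 : 0 < y) (hy1 : y < 1)
    (hz0 : 0 ≤ z) (hz1 : z ≤ 1) (h : (m + z) * (m + y) = (b : ℝ) ^ n) : m = k ∧ n = 1 := by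
  have hm' : (1 : ℝ) ≤ m := by exact_mod_cast hm
  have hlo : m ^ 2 < b ^ n := by
    have : (m : ℝ) ^ 2 < (b : ℝ) ^ n := by nlinarith
    exact_mod_cast this
  have hhi : b ^ n < (m + 1) ^ 2 := by
    have : (b : ℝ) ^ n < ((m : ℝ) + 1) ^ 2 := by nlinarith
    exact_mod_cast this
  have hb1 : 1 < b := by nlinarith
  have hn1 : n = 1 := by
    obtain ⟨r, rfl⟩ : ∃ r, n = r + 1 := ⟨n - 1, by omega⟩
    rcases Nat.eq_zero_or_pos r with rfl | hr
    · rfl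
    · exfalso
      rw [pow_succ'] at hbn
      have h0 : b ^ (r + 1) = b * b ^ r := pow_succ' b r
      have h1 : b ^ r ≤ m := Nat.le_of_mul_le_mul_left hbn (by omega)
      have h2 : b ≤ b ^ r := Nat.le_self_pow hr.ne' b
      nlinarith
  subst hn1
  rw [pow_one] at hlo hhi
  refine ⟨?_, rfl⟩
  have h1 : m < k + 1 := by nlinarith
  have h2 : k < m + 1 := by nlinarith
  omega

/-- The arithmetic content of a Trott expansion in base `k ^ 2 + j`: the first partial quotient
is `k`, and the second one is tied to its digit count. -/
lemma trott_structure {b k j : ℕ} {x : ℝ} {a : ℕ → ℕ} (hb : b = k ^ 2 + j) (hk : 0 < k)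
    (hj1 : 1 ≤ j) (hj2 : j ≤ k) (h : IsTrottWith b x a) :
    ∃ A n : ℕ, ∃ v w : ℝ, 0 < A ∧ 0 < n ∧ A < b ^ n ∧ b ^ n ≤ b * A ∧ 0 < v ∧ v < 1 ∧
      1 / (b : ℝ) ≤ w ∧ w ≤ 1 ∧ 1 / x = k + 1 / (A + v) ∧
      ((A : ℝ) + w) * (k * (A + v) + 1) = (b : ℝ) ^ n * (j * (A + v) - k) := by
  obtain ⟨ha, hcf, hx⟩ := h
  have hb2 : 2 ≤ b := by nlinarith
  change x = concatVal b a at hx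
  have hcf0 : IsCF a x := hcf
  have ha1 : ∀ i, 0 < a (i + 1) := fun i => ha _
  have hcf1 := hcf0.tail ha
  have hcf2 := hcf1.tail ha1
  have hx0 := hcf0.pos ha
  set y := 1 / x - a 0 with hy
  have hy0 := hcf1.pos ha1
  set v := 1 / y - a (0 + 1) with hv
  have e0 := concatVal_eq hb2 a
  have e1 := concatVal_eq hb2 (fun i => a (i + 1))
  simp only [zero_add] at e1 hv
  rw [← hx] at e0
  have hxy : 1 = x * (a 0 + y) := by rw [hy]; field_simp; ring
  obtain ⟨hk0, hn1⟩ := first_quotient (m := a 0) (y := y) hb hk hj1 hj2 (ha 0)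
    (digLen_pos (ha 0)) (pow_digLen_le hb2 (ha 0)) hy0 (hcf1.lt_one ha1)
    (concatVal_nonneg b fun i => a (i + 1)) (concatVal_le_one hb2 _) (by
      rw [← e0]; linear_combination (-(b : ℝ) ^ digLen b (a 0)) * hxy)
  have hv0 : 0 < v := hcf2.pos fun i => ha1 (i + 1)
  have hAv : (a 1 : ℝ) + v = 1 / y := by rw [hv]; ring
  refine ⟨a 1, digLen b (a 1), v, concatVal b (fun i => a (i + 1 + 1)), ha 1,
    digLen_pos (ha 1), lt_pow_digLen hb2 _, pow_digLen_le hb2 (ha 1), hv0,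
    hcf2.lt_one fun i => ha1 (i + 1), inv_le_concatVal hb2 (ha 2), concatVal_le_one hb2 _, ?_, ?_⟩
  · rw [hAv, one_div_one_div, hy, hk0]; ring
  · rw [hn1, pow_one, hk0] at e0
    rw [hk0] at hxy
    have hbr : (b : ℝ) = k ^ 2 + j := by exact_mod_cast hb
    rw [hAv, ← e1]
    set z := concatVal b (fun i => a (i + 1))
    have hz : (k + z) * (k + y) = k ^ 2 + j := by
      rw [← hbr, ← e0]; linear_combination (-(b : ℝ)) * hxy
    field_simp
    linear_combination hz

/-! ### Size estimates -/

lemma quotient_error {k U α β B : ℝ} (hk : 3 ≤ k) (hβ1 : 1 ≤ β) (hβk : β ≤ k) (hα1 : -1 ≤ α)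
    (hα2 : α ≤ 1) (hU : k ^ 8 ≤ U) (h : (U + α) * (k * U + 1) = B * (U - β)) :
    0 ≤ B - k * U - 1 - k * α - k * β ∧ B - k * U - 1 - k * α - k * β < 1 / (k + 1) := by
  set e := B - k * U - 1 - k * α - k * β with he
  have hk4 : 81 ≤ k ^ 4 := by nlinarith [sq_nonneg (k ^ 2 - 9), sq_nonneg (k - 3)]
  have hk8 : 81 * k ^ 4 ≤ k ^ 8 := by nlinarith
  have hk3 : k ^ 3 ≤ k ^ 4 := pow_le_pow_right₀ (by linarith) (by norm_num)
  have hk2 : k ^ 2 ≤ k ^ 4 := pow_le_pow_right₀ (by linarith) (by norm_num)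
  have hk1 : k ≤ k ^ 4 := le_self_pow₀ (by linarith) (by norm_num)
  have hpos : 0 < U - β := by linarith
  have hE : e * (U - β) = (β + α) * (k * β + 1) := by rw [he]; linear_combination -h
  have hub : (β + α) * (k * β + 1) ≤ (k + 1) * (k ^ 2 + 1) := by
    have : 0 ≤ k * β + 1 := by positivity
    gcongr
    nlinarith
  have hlb : 0 ≤ (β + α) * (k * β + 1) := mul_nonneg (by linarith) (by positivity)
  refine ⟨by by_contra! hneg; nlinarith, ?_⟩
  rw [lt_div_iff₀ (by linarith)]
  by_contra! hge
  have h1 : (U - β) * 1 ≤ (U - β) * (e * (k + 1)) := by gcongr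
  have h2 : (e * (U - β)) * (k + 1) ≤ ((k + 1) * (k ^ 2 + 1)) * (k + 1) := by
    rw [hE]; gcongr
  nlinarith

lemma digit_count_lt {k j b c n n' A : ℕ} {v w w' : ℝ} (hk : 3 ≤ k) (hb : b = k ^ 2 + j)
    (hc : c = b + 2) (hA : 0 < A) (hn : 0 < n) (hv : 0 < v)
    (hw : 0 ≤ w) (hw' : w' ≤ 1)
    (h1 : ((A : ℝ) + w) * (k * (A + v) + 1) = (b : ℝ) ^ n * (j * (A + v) - k))
    (h2 : ((A : ℝ) + w') * (k * (A + v) + 1) = (c : ℝ) ^ n' * ((j + 2) * (A + v) - k)) :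
    n' < n := by
  by_contra! hle
  have hkr : (3 : ℝ) ≤ k := by exact_mod_cast hk
  have hAr : (1 : ℝ) ≤ A := by exact_mod_cast hA
  have hbr : (9 : ℝ) ≤ b := by exact_mod_cast (by nlinarith : 9 ≤ b)
  have hbk : (k : ℝ) ^ 2 ≤ b := by exact_mod_cast (by omega : k ^ 2 ≤ b)
  have hcr : (c : ℝ) = b + 2 := by exact_mod_cast hc
  set U : ℝ := A + v with hU
  have hU1 : 1 < U := by linarith
  have hP : 0 < (k : ℝ) * U + 1 := by positivity
  have hbn : (0 : ℝ) < (b : ℝ) ^ n := by positivity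
  have hc0 : (0 : ℝ) < c := by linarith
  have hcn : (0 : ℝ) < (c : ℝ) ^ n := by positivity
  have hbc : (b : ℝ) ^ n ≤ (c : ℝ) ^ n := by gcongr; linarith
  have hcc : (c : ℝ) ^ n ≤ (c : ℝ) ^ n' := pow_le_pow_right₀ (by linarith) hle
  have hc1 : (c : ℝ) ≤ (c : ℝ) ^ n := le_self_pow₀ (by linarith) hn.ne'
  have h3 : 0 ≤ (j : ℝ) * U - k := by
    by_contra! hneg
    have : 0 ≤ ((A : ℝ) + w) * (k * U + 1) := by positivity
    nlinarith
  have h4 : (c : ℝ) ^ n * ((j + 2) * U - k) ≤ (A + 1) * (k * U + 1) := by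
    calc (c : ℝ) ^ n * ((j + 2) * U - k) ≤ (c : ℝ) ^ n' * ((j + 2) * U - k) := by
          gcongr; nlinarith
      _ = (A + w') * (k * U + 1) := h2.symm
      _ ≤ (A + 1) * (k * U + 1) := by gcongr
  have h5 : A * (k * U + 1) ≤ (c : ℝ) ^ n * (j * U - k) := by
    calc A * (k * U + 1) ≤ (A + w) * (k * U + 1) := by gcongr; linarith
      _ = (b : ℝ) ^ n * (j * U - k) := h1
      _ ≤ (c : ℝ) ^ n * (j * U - k) := by gcongr
  have h6 : (c : ℝ) ^ n * (2 * U) ≤ k * U + 1 := by linarith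
  have h7 : (c : ℝ) * (2 * U) ≤ (c : ℝ) ^ n * (2 * U) := by gcongr
  nlinarith

lemma five_le_digit_count {k j b c n n' A : ℕ} {v w : ℝ} (hk : 3 ≤ k) (hj : 1 ≤ j)
    (hb : b = k ^ 2 + j) (hc : c = b + 2) (hbA : b ≤ A) (hnn : n' < n) (hAc : A < c ^ n')
    (hv : 0 < v) (hw : w ≤ 1)
    (h1 : ((A : ℝ) + w) * (k * (A + v) + 1) = (b : ℝ) ^ n * (j * (A + v) - k)) : 5 ≤ n := by
  by_contra! hlt
  obtain ⟨r, rfl⟩ : ∃ r, n = r + 1 := ⟨n - 1, by omega⟩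
  have hkr : (3 : ℝ) ≤ k := by exact_mod_cast hk
  have hjr : (1 : ℝ) ≤ j := by exact_mod_cast hj
  have hbk : (k : ℝ) ^ 2 + 1 ≤ b := by exact_mod_cast (by omega : k ^ 2 + 1 ≤ b)
  have hbA' : (b : ℝ) ≤ A := by exact_mod_cast hbA
  have hcr : (c : ℝ) = b + 2 := by exact_mod_cast hc
  have hAc' : (A : ℝ) + 1 ≤ (c : ℝ) ^ n' := by exact_mod_cast hAc
  set U : ℝ := A + v with hU
  have hb10 : (10 : ℝ) ≤ b := by nlinarith
  have hb0 : (0 : ℝ) < (b : ℝ) ^ r := by positivity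
  have hP : 0 < (k : ℝ) * U + 1 := by positivity
  have hcb : (c : ℝ) ^ n' ≤ 1.728 * (b : ℝ) ^ r := by
    calc (c : ℝ) ^ n' ≤ (c : ℝ) ^ r := pow_le_pow_right₀ (by linarith) (by omega)
      _ ≤ (1.2 * (b : ℝ)) ^ r := by gcongr; linarith
      _ = 1.2 ^ r * (b : ℝ) ^ r := mul_pow _ _ _
      _ ≤ 1.2 ^ 3 * (b : ℝ) ^ r := by
          gcongr
          · norm_num
          · omega
      _ = 1.728 * (b : ℝ) ^ r := by norm_num
  have h3 : (b : ℝ) ^ r * (b * (U - k)) ≤ (b : ℝ) ^ r * (1.728 * (k * U + 1)) := by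
    calc (b : ℝ) ^ r * (b * (U - k)) = (b : ℝ) ^ (r + 1) * (1 * U - k) := by ring
      _ ≤ (b : ℝ) ^ (r + 1) * (j * U - k) := by gcongr
      _ = (A + w) * (k * U + 1) := h1.symm
      _ ≤ (1.728 * (b : ℝ) ^ r) * (k * U + 1) := by gcongr; linarith
      _ = _ := by ring
  have h4 := le_of_mul_le_mul_left h3 hb0
  have h5 : (k : ℝ) ^ 2 + 1 ≤ U := by linarith
  have h6 : (3 * k + 1) * (U - k) ≤ b * (U - k) := by
    have : (k : ℝ) ≤ U := by nlinarith
    gcongr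
    nlinarith
  have h7 : (k : ℝ) * (k ^ 2 + 1) ≤ k * U := by gcongr
  nlinarith [mul_le_mul_of_nonneg_right hkr (sq_nonneg (k : ℝ))]

lemma difference_bounds {k j b c n n' A : ℕ} {v w w' : ℝ} (hk : 3 ≤ k) (hj1 : 1 ≤ j)
    (hj2 : j + 2 ≤ k) (hb : b = k ^ 2 + j) (hA : b ^ 4 ≤ A) (hv0 : 0 < v) (hv1 : v < 1)
    (hw0 : 1 / (b : ℝ) ≤ w) (hw1 : w ≤ 1) (hw0' : 0 ≤ w') (hw1' : w' ≤ 1)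
    (hE : (k : ℝ) - 2 ≤ 2 * (k : ℝ) ^ 2 / (j * (j + 2)))
    (h1 : ((A : ℝ) + w) * (k * (A + v) + 1) = (b : ℝ) ^ n * (j * (A + v) - k))
    (h2 : ((A : ℝ) + w') * (k * (A + v) + 1) = (c : ℝ) ^ n' * ((j + 2) * (A + v) - k)) :
    -2 < (b : ℝ) ^ n * j - (c : ℝ) ^ n' * (j + 2) ∧
      (b : ℝ) ^ n * j - (c : ℝ) ^ n' * (j + 2) < 2 * (k : ℝ) ^ 2 / (j * (j + 2)) + k + 1 := by
  have hkr : (3 : ℝ) ≤ k := by exact_mod_cast hk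
  have hjr : (1 : ℝ) ≤ j := by exact_mod_cast hj1
  have hjk : (j : ℝ) + 2 ≤ k := by exact_mod_cast hj2
  have hbr : (b : ℝ) = k ^ 2 + j := by exact_mod_cast hb
  have hAr : (b : ℝ) ^ 4 ≤ A := by exact_mod_cast hA
  have hb0 : (0 : ℝ) < b := by rw [hbr]; positivity
  have hw : 0 ≤ w := le_trans (by positivity) hw0
  have hU : (k : ℝ) ^ 8 ≤ A + v := by
    calc (k : ℝ) ^ 8 = (k ^ 2) ^ 4 := by ring
      _ ≤ (b : ℝ) ^ 4 := by gcongr; linarith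
      _ ≤ A + v := by linarith
  obtain ⟨p1, p2⟩ := quotient_error (U := A + v) (α := w - v) (β := k / j) (B := b ^ n * j) hkr
    (by rw [le_div_iff₀ (by linarith)]; linarith) (div_le_self (by linarith) hjr)
    (by linarith) (by linarith) hU (by
      have : (j : ℝ) * (k / j) = k := by field_simp
      linear_combination h1 + (b : ℝ) ^ n * this)
  obtain ⟨q1, q2⟩ := quotient_error (U := A + v) (α := w' - v) (β := k / (j + 2))
    (B := c ^ n' * (j + 2)) hkr
    (by rw [le_div_iff₀ (by linarith)]; linarith) (div_le_self (by linarith) (by linarith))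
    (by linarith) (by linarith) hU (by
      have : ((j : ℝ) + 2) * (k / (j + 2)) = k := by field_simp
      linear_combination h2 + (c : ℝ) ^ n' * this)
  have hEeq : 2 * (k : ℝ) ^ 2 / (j * (j + 2)) = k * (k / j) - k * (k / (j + 2)) := by
    field_simp; ring
  rw [hEeq] at hE ⊢
  have hkb : 1 / ((k : ℝ) + 1) ≤ k * w := by
    calc 1 / ((k : ℝ) + 1) ≤ k * (1 / b) := by
          rw [mul_one_div, div_le_div_iff₀ (by linarith) hb0]; nlinarith
      _ ≤ k * w := by gcongr
  have hkw : (k : ℝ) * w' ≤ k := by nlinarith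
  have hkw' : (0 : ℝ) ≤ k * w' := by positivity
  have hkw1 : (k : ℝ) * w ≤ k := by nlinarith
  have h1k : 1 / ((k : ℝ) + 1) ≤ 1 := by rw [div_le_one (by linarith)]; linarith
  constructor <;> linarith

/-! ### Congruences -/

lemma difference_dvd (b j : ℤ) (n n' : ℕ) :
    b + 1 ∣ (b ^ n * j - (b + 2) ^ n' * (j + 2)) + 2 ∨
      b + 1 ∣ (b ^ n * j - (b + 2) ^ n' * (j + 2)) + 2 * j + 2 := by
  have hb : b ^ n ≡ (-1) ^ n [ZMOD b + 1] :=
    (Int.modEq_iff_dvd.2 ⟨-1, by ring⟩ : b ≡ -1 [ZMOD b + 1]).pow n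
  have hc : (b + 2) ^ n' ≡ 1 ^ n' [ZMOD b + 1] :=
    (Int.modEq_iff_dvd.2 ⟨-1, by ring⟩ : b + 2 ≡ 1 [ZMOD b + 1]).pow n'
  obtain ⟨s, hs⟩ := hb.symm.dvd
  obtain ⟨t, ht⟩ := hc.symm.dvd
  rw [one_pow] at ht
  rcases Nat.even_or_odd n with h | h
  · rw [h.neg_one_pow] at hs
    exact Or.inl ⟨s * j - t * (j + 2), by linear_combination j * hs - (j + 2) * ht⟩
  · rw [h.neg_one_pow] at hs
    exact Or.inr ⟨s * j - t * (j + 2), by linear_combination j * hs - (j + 2) * ht⟩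

lemma difference_large {k j n n' : ℕ} (hk : 3 ≤ k) (hj1 : 1 ≤ j) (hj2 : j + 2 ≤ k)
    (hn : 0 < n) (hn' : 0 < n') {D : ℤ}
    (hD : D = ((k : ℤ) ^ 2 + j) ^ n * j - ((k : ℤ) ^ 2 + j + 2) ^ n' * (j + 2)) (hlo : -2 < D) :
    2 * (k : ℤ) ^ 2 + (k + 1) * (j * (j + 2)) ≤ D * (j * (j + 2)) := by
  have hkz : (3 : ℤ) ≤ k := by exact_mod_cast hk
  have hjz : (1 : ℤ) ≤ j := by exact_mod_cast hj1
  have hjk : (j : ℤ) + 2 ≤ k := by exact_mod_cast hj2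
  have hD' : (k : ℤ) ^ 2 - j - 1 ≤ D := by
    rcases difference_dvd ((k : ℤ) ^ 2 + j) j n n' with h | h
    · rw [← hD] at h
      have := Int.le_of_dvd (by linarith) h
      linarith
    · rw [← hD] at h
      have := Int.le_of_dvd (by linarith) h
      linarith
  rcases Nat.lt_or_ge j 2 with hj | hj
  · obtain rfl : j = 1 := by omega
    rcases (by omega : k = 3 ∨ k = 4 ∨ 5 ≤ k) with rfl | rfl | h5
    · have hpar : (2 : ℤ) ∣ D := by
        rw [hD]
        push_cast
        exact dvd_sub (((by norm_num : (2 : ℤ) ∣ 3 ^ 2 + 1).trans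
          (dvd_pow_self _ hn.ne')).mul_right _) (((by norm_num : (2 : ℤ) ∣ 3 ^ 2 + 1 + 2).trans
          (dvd_pow_self _ hn'.ne')).mul_right _)
      have h11 := difference_dvd (((3 : ℕ) : ℤ) ^ 2 + (1 : ℕ)) (1 : ℕ) n n'
      rw [← hD] at h11
      push_cast at h11 hD' ⊢
      omega
    · have h18 := difference_dvd (((4 : ℕ) : ℤ) ^ 2 + (1 : ℕ)) (1 : ℕ) n n'
      rw [← hD] at h18
      have h19 : D ≠ 14 := by
        intro h14
        have e : (17 : ZMod 19) ^ n = 14 := by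
          have := congrArg (Int.cast : ℤ → ZMod 19) (h14.symm.trans hD)
          push_cast at this
          norm_num at this
          have h0 : (19 : ZMod 19) = 0 := by decide
          rw [h0, zero_pow hn'.ne'] at this
          simpa using this.symm
        have hord : (17 : ZMod 19) ^ 9 = 1 := by decide
        have e9 : (14 : ZMod 19) ^ 9 = 1 := by rw [← e, ← pow_mul, mul_comm, pow_mul, hord, one_pow]
        exact absurd e9 (by decide)
      push_cast at h18 hD' ⊢
      omega
    · have h5z : (5 : ℤ) ≤ k := by exact_mod_cast h5
      push_cast at hD' ⊢
      nlinarith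
  · have hj2z : (2 : ℤ) ≤ j := by exact_mod_cast hj
    have h8 : (8 : ℤ) ≤ j * (j + 2) := by nlinarith
    have hgap : (k : ℤ) ^ 2 ≤ 4 * (D - k - 1) := by nlinarith
    nlinarith

/-- For `k ≥ 3` and `1 ≤ j ≤ k-2` with `j ≤ √(2k²/(k-2) + 1) - 1`, no number is Trott
in both base `k²+j` and base `k²+j+2`. -/
theorem trott_not_bases_two_apart (k j : ℕ) (hk : 3 ≤ k) (hj1 : 1 ≤ j) (hj2 : j ≤ k - 2)
    (hj3 : (j : ℝ) ≤ Real.sqrt (2 * (k : ℝ) ^ 2 / ((k : ℝ) - 2) + 1) - 1) :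
    TrottSet (k ^ 2 + j) ∩ TrottSet (k ^ 2 + j + 2) = ∅ := by
  have hjk : j + 2 ≤ k := by omega
  have hkr : (3 : ℝ) ≤ k := by exact_mod_cast hk
  have hjr : (1 : ℝ) ≤ j := by exact_mod_cast hj1
  have hE : (k : ℝ) - 2 ≤ 2 * (k : ℝ) ^ 2 / (j * (j + 2)) := by
    have hk2 : (0 : ℝ) < k - 2 := by linarith
    have h1 : ((j : ℝ) + 1) ^ 2 ≤ 2 * (k : ℝ) ^ 2 / (k - 2) + 1 :=
      (Real.le_sqrt (by linarith) (by positivity)).1 (by linarith)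
    have h2 : (j : ℝ) * (j + 2) ≤ 2 * (k : ℝ) ^ 2 / (k - 2) := by linarith
    rw [le_div_iff₀ hk2] at h2
    rw [le_div_iff₀ (by positivity)]
    linarith
  refine Set.eq_empty_iff_forall_notMem.2 ?_
  rintro x ⟨⟨a, ha⟩, ⟨a', ha'⟩⟩
  obtain ⟨A, n, v, w, hA, hn, -, hbn, hv0, hv1, hw0, hw1, hx, h1⟩ :=
    trott_structure rfl (by omega) hj1 (by omega) ha
  obtain ⟨A', n', v', w', -, hn', hAc, -, hv0', hv1', hw0', hw1', hx', h2⟩ :=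
    trott_structure (k := k) (j := j + 2) (by ring) (by omega) (by omega) (by omega) ha'
  have hAv : (A : ℝ) + v = A' + v' := by
    have : 1 / ((A : ℝ) + v) = 1 / (A' + v') := by linarith
    simpa using this
  obtain rfl : A = A' := by
    have l1 : A < A' + 1 := by
      have : (A : ℝ) < A' + 1 := by linarith
      exact_mod_cast this
    have l2 : A' < A + 1 := by
      have : (A' : ℝ) < A + 1 := by linarith
      exact_mod_cast this
    omega
  obtain rfl : v = v' := by linarith
  have hb0 : 0 < k ^ 2 + j := by omega
  have hw : 0 ≤ w := le_trans (by positivity) hw0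
  have hw' : 0 ≤ w' := le_trans (by positivity) hw0'
  push_cast at h2
  have hnn : n' < n := digit_count_lt (c := k ^ 2 + j + 2) hk rfl rfl hA hn hv0 hw hw1' h1
    (by push_cast; exact h2)
  obtain ⟨r, rfl⟩ : ∃ r, n = r + 1 := ⟨n - 1, by omega⟩
  have hbr : (k ^ 2 + j) ^ r ≤ A := by
    rw [pow_succ'] at hbn
    exact Nat.le_of_mul_le_mul_left hbn hb0
  have hn5 := five_le_digit_count hk hj1 rfl rfl
    ((Nat.le_self_pow (by omega) _).trans hbr) hnn hAc hv0 hw1 h1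
  have hA4 : (k ^ 2 + j) ^ 4 ≤ A := (Nat.pow_le_pow_right hb0 (by omega)).trans hbr
  obtain ⟨hlo, hhi⟩ := difference_bounds (c := k ^ 2 + j + 2) hk hj1 hjk rfl hA4 hv0 hv1 hw0 hw1
    hw' hw1' hE h1 (by push_cast; exact h2)
  have hlarge := difference_large (n := r + 1) hk hj1 hjk hn hn' rfl (by
    push_cast at hlo
    exact_mod_cast hlo)
  have hlarge' : 2 * (k : ℝ) ^ 2 + (k + 1) * (j * (j + 2)) ≤
      (((k : ℝ) ^ 2 + j) ^ (r + 1) * j - ((k : ℝ) ^ 2 + j + 2) ^ n' * (j + 2)) * (j * (j + 2)) := by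
    exact_mod_cast hlarge
  have hpos : (0 : ℝ) < j * (j + 2) := by positivity
  push_cast at hhi
  rw [← sub_lt_iff_lt_add, ← sub_lt_iff_lt_add, lt_div_iff₀ hpos] at hhi
  linarith
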